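/- arXiv:1411.7260 — 2 statements merged into one kernel-verified Lean document; each statement's English description precedes it below -/
import Mathlib

section
/- Let φ : (A, m_A) → (B, m_B) be a flat local homomorphism of Noetherian local rings. If B is a regular local ring, then A is a regular local ring. -/
/-- A regular local ring: a Noetherian local ring whose maximal ideal is
generated by `dim R` elements. -/
def IsRegularLocal (R : Type*) [CommRing R] [IsLocalRing R] : Prop :=
  IsNoetherianRing R ∧ ∃ s : Finset R,
    Ideal.span (s : Set R) = IsLocalRing.maximalIdeal R ∧
    ((s.card : ℕ∞) : WithBot ℕ∞) = ringKrullDim R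

section

open CategoryTheory IsLocalRing Module

universe w u v

namespace IsLocalRing

variable {R : Type u} [CommRing R] [IsLocalRing R]

lemma maximalIdeal_ne_bot_of_ringKrullDim_eq_succ {n : ℕ} (h : ringKrullDim R = (n + 1 : ℕ)) :
    maximalIdeal R ≠ ⊥ := by
  intro hbot
  rw [ringKrullDim_eq_zero_of_isField (isField_iff_maximalIdeal_eq.mpr hbot)] at h
  norm_cast at h

/-- Prime avoidance for an element of `𝔪` that is to avoid `𝔪 ^ 2` as well. -/
lemma exists_mem_maximalIdeal_notMem_sq [IsNoetherianRing R] (hm : maximalIdeal R ≠ ⊥)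
    {S : Set (Ideal R)} (hS : S.Finite) (hprime : ∀ p ∈ S, p.IsPrime)
    (hne : ∀ p ∈ S, p ≠ maximalIdeal R) :
    ∃ x ∈ maximalIdeal R, x ∉ maximalIdeal R ^ 2 ∧ ∀ p ∈ S, x ∉ p := by
  by_contra! h
  have hsub : (maximalIdeal R : Set R) ⊆ ⋃ p ∈ insert (maximalIdeal R ^ 2) S, (p : Set R) := by
    intro x hx
    by_cases hx2 : x ∈ maximalIdeal R ^ 2
    · exact Set.mem_biUnion (Set.mem_insert _ _) hx2
    · obtain ⟨p, hp, hxp⟩ := h x hx hx2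
      exact Set.mem_biUnion (Set.mem_insert_of_mem _ hp) hxp
  obtain ⟨p, hp, hle⟩ := (Ideal.subset_union_prime_finite (f := fun p : Ideal R ↦ p)
    (hS.insert (maximalIdeal R ^ 2)) (maximalIdeal R ^ 2) (maximalIdeal R ^ 2)
    (fun p hp hp2 _ ↦ hprime p (hp.resolve_left hp2))).mp hsub
  rcases hp with rfl | hp
  · refine hm (Submodule.eq_bot_of_le_smul_of_le_jacobson_bot _ _
      (IsNoetherian.noetherian _) (hle.trans (pow_two (maximalIdeal R)).le)
      (maximalIdeal_le_jacobson _))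
  · exact hne p hp ((eq_maximalIdeal ((maximalIdeal.isMaximal R).eq_of_le
      (hprime p hp).ne_top hle ▸ maximalIdeal.isMaximal R)))

/-- An element outside `𝔪 ^ 2` can replace a member of any finite generating set of `𝔪`. -/
lemma exists_finset_span_insert_eq_maximalIdeal [DecidableEq R] {s : Finset R}
    (hs : Ideal.span (s : Set R) = maximalIdeal R) {x : R} (hx : x ∈ maximalIdeal R)
    (hx2 : x ∉ maximalIdeal R ^ 2) :
    ∃ t : Finset R, t.card + 1 = s.card ∧
      Ideal.span (insert x (t : Set R)) = maximalIdeal R := by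
  have hsm (a : R) (ha : a ∈ s) : a ∈ maximalIdeal R := hs ▸ Ideal.subset_span ha
  obtain ⟨f, -, hf⟩ := Submodule.mem_span_finset.mp (show x ∈ Ideal.span (s : Set R) from hs ▸ hx)
  obtain ⟨a, ha, hfa⟩ : ∃ a ∈ s, f a ∉ maximalIdeal R := by
    by_contra! h
    refine hx2 (hf ▸ Ideal.sum_mem _ fun a ha ↦ ?_)
    rw [pow_two]
    exact Ideal.mul_mem_mul (h a ha) (hsm a ha)
  refine ⟨s.erase a, Finset.card_erase_add_one ha, le_antisymm ?_ ?_⟩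
  · refine Ideal.span_le.mpr (Set.insert_subset hx fun b hb ↦ hsm b ?_)
    exact Finset.mem_of_mem_erase hb
  · rw [← hs, Ideal.span_le]
    intro b hb
    by_cases hba : b = a
    · subst hba
      refine (Ideal.unit_mul_mem_iff_mem _ (notMem_maximalIdeal.mp hfa)).mp ?_
      rw [← Finset.add_sum_erase s _ ha] at hf
      have : f b * b = x - ∑ c ∈ s.erase b, f c * c := by
        rw [← hf]; simp
      rw [this]
      refine Ideal.sub_mem _ (Ideal.subset_span (Set.mem_insert _ _))
        (Ideal.sum_mem _ fun c hc ↦ Ideal.mul_mem_left _ _ (Ideal.subset_span ?_))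
      exact Set.mem_insert_of_mem _ hc
    · exact Ideal.subset_span (Set.mem_insert_of_mem _ (Finset.mem_erase.mpr ⟨hba, hb⟩))

lemma isLocalRing_quotient_span_singleton {x : R} (hx : x ∈ maximalIdeal R) :
    IsLocalRing (R ⧸ Ideal.span {x}) :=
  have : Nontrivial (R ⧸ Ideal.span {x}) :=
    Ideal.Quotient.nontrivial_iff.mpr
      (Ideal.span_singleton_ne_top ((mem_maximalIdeal x).mp hx))
  .of_surjective' (Ideal.Quotient.mk _) Ideal.Quotient.mk_surjective

lemma map_mk_maximalIdeal {x : R} [IsLocalRing (R ⧸ Ideal.span {x})] :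
    (maximalIdeal R).map (Ideal.Quotient.mk (Ideal.span {x})) =
      maximalIdeal (R ⧸ Ideal.span {x}) :=
  IsLocalRing.map_maximalIdeal_of_surjective _ Ideal.Quotient.mk_surjective

end IsLocalRing

namespace IsRegularLocalRing

variable {R : Type u} [CommRing R]

lemma exists_finset [IsRegularLocalRing R] : ∃ s : Finset R,
    Ideal.span (s : Set R) = maximalIdeal R ∧ (s.card : WithBot ℕ∞) = ringKrullDim R := by
  have hfg := (maximalIdeal R).fg_of_isNoetherianRing
  refine ⟨(Submodule.FG.finite_generators hfg).toFinset, ?_, ?_⟩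
  · simpa using! (maximalIdeal R).span_generators
  · rw [← (isRegularLocalRing_iff R).mp ‹_›, ← Submodule.FG.generators_ncard hfg,
      Set.ncard_eq_toFinset_card _ (Submodule.FG.finite_generators hfg)]

lemma of_span_finset_eq_maximalIdeal [IsLocalRing R] [IsNoetherianRing R] (s : Finset R)
    (hs : Ideal.span (s : Set R) = maximalIdeal R)
    (hcard : (s.card : WithBot ℕ∞) ≤ ringKrullDim R) : IsRegularLocalRing R := by
  refine of_spanFinrank_maximalIdeal_le R (le_trans ?_ hcard)
  rw [← hs, Nat.cast_le, ← Set.ncard_coe_finset]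
  exact Submodule.spanFinrank_span_le_ncard_of_finite s.finite_toSet

lemma quotient_span_singleton [IsRegularLocalRing R] {n : ℕ} (hdim : ringKrullDim R = n + 1)
    {x : R} (hx : x ∈ maximalIdeal R) (hx2 : x ∉ maximalIdeal R ^ 2) :
    IsRegularLocalRing (R ⧸ Ideal.span {x}) ∧ ringKrullDim (R ⧸ Ideal.span {x}) = n := by
  classical
  have := isLocalRing_quotient_span_singleton hx
  obtain ⟨s, hs, hcard⟩ := exists_finset (R := R)
  obtain ⟨t, ht, hspan⟩ := exists_finset_span_insert_eq_maximalIdeal hs hx hx2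
  let π := Ideal.Quotient.mk (Ideal.span {x})
  have hπx : π x = 0 := Ideal.Quotient.eq_zero_iff_mem.mpr (Ideal.mem_span_singleton_self x)
  have htn : t.card = n := by
    rw [hdim, ← ht] at hcard
    exact Nat.add_right_cancel (m := 1) (by exact_mod_cast hcard)
  have hle : (n : WithBot ℕ∞) ≤ ringKrullDim (R ⧸ Ideal.span {x}) := by
    have h := ringKrullDim_le_ringKrullDim_quotient_add_card ({x} : Finset R)
      (by simpa [IsLocalRing.ringJacobson_eq_maximalIdeal] using hx)
    rw [hdim, Finset.card_singleton, Nat.cast_one, Finset.coe_singleton] at h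
    exact ENat.WithBot.add_le_add_one_right_iff.mp h
  have hspan' : Ideal.span ((t.image π : Finset _) : Set (R ⧸ Ideal.span {x})) =
      maximalIdeal (R ⧸ Ideal.span {x}) := by
    rw [← map_mk_maximalIdeal, ← hspan, Ideal.map_span, Set.image_insert_eq, hπx,
      Finset.coe_image, Ideal.span_insert_zero]
  have hcard' : ((t.image π).card : WithBot ℕ∞) ≤ n := by
    rw [← htn]
    exact_mod_cast Finset.card_image_le
  have hreg := of_span_finset_eq_maximalIdeal _ hspan' (hcard'.trans hle)
  refine ⟨hreg, le_antisymm ?_ hle⟩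
  refine (ringKrullDim_le_spanFinrank_maximalIdeal _).trans (le_trans ?_ hcard')
  rw [← hspan', Nat.cast_le, ← Set.ncard_coe_finset]
  exact Submodule.spanFinrank_span_le_ncard_of_finite (Finset.finite_toSet _)

lemma isField_of_ringKrullDim_eq_zero [IsRegularLocalRing R] (h : ringKrullDim R = 0) :
    IsField R := by
  obtain ⟨s, hs, hcard⟩ := exists_finset (R := R)
  rw [h] at hcard
  have : s = ∅ := Finset.card_eq_zero.mp (by exact_mod_cast hcard)
  rw [isField_iff_maximalIdeal_eq, ← hs, this]
  simp

lemma isDomain_of_ringKrullDim_eq (n : ℕ) (R : Type u) [CommRing R] [IsRegularLocalRing R]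
    (h : ringKrullDim R = n) : IsDomain R := by
  induction n generalizing R with
  | zero => exact (isField_of_ringKrullDim_eq_zero (by simpa using h)).isDomain
  | succ n ih =>
    have hm : maximalIdeal R ∉ minimalPrimes R := by
      intro hmin
      have h0 := Ideal.height_eq_zero_iff.mpr hmin
      rw [← maximalIdeal_height_eq_ringKrullDim, h0] at h
      norm_cast at h
    have hbot := maximalIdeal_ne_bot_of_ringKrullDim_eq_succ h
    obtain ⟨x, hx, hx2, hxp⟩ := exists_mem_maximalIdeal_notMem_sq hbot
      (minimalPrimes.finite_of_isNoetherianRing R) (fun p hp ↦ hp.1.1)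
      (fun p hp hpm ↦ hm (hpm ▸ hp))
    obtain ⟨_, hdim⟩ := quotient_span_singleton (by simpa using h) hx hx2
    have := ih _ hdim
    have hprime : (Ideal.span {x}).IsPrime := (Ideal.Quotient.isDomain_iff_prime _).mp this
    obtain ⟨q, hq, hqx⟩ := Ideal.exists_minimalPrimes_le (bot_le (a := Ideal.span {x}))
    have hqprime : q.IsPrime := hq.1.1
    have hq0 : q = ⊥ := by
      refine Submodule.eq_bot_of_le_smul_of_le_jacobson_bot (maximalIdeal R) _
        (IsNoetherian.noetherian _) (fun y hy ↦ ?_) (maximalIdeal_le_jacobson _)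
      obtain ⟨z, rfl⟩ := Ideal.mem_span_singleton.mp (hqx hy)
      exact Submodule.smul_mem_smul hx ((hqprime.mem_or_mem hy).resolve_left (hxp q hq))
    subst hq0
    exact IsDomain.of_bot_isPrime R

lemma of_quotient_span_singleton [IsLocalRing R] [IsNoetherianRing R] {x : R}
    (hx : x ∈ maximalIdeal R) (hreg : IsSMulRegular R x)
    [IsRegularLocalRing (R ⧸ Ideal.span {x})] : IsRegularLocalRing R := by
  classical
  obtain ⟨s, hs, hcard⟩ := exists_finset (R := R ⧸ Ideal.span {x})
  let π := Ideal.Quotient.mk (Ideal.span {x})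
  let t := s.image (Function.surjInv (f := π) Ideal.Quotient.mk_surjective)
  have himage : Set.image π t = s := by
    simp [t, ← Set.image_comp, Function.surjInv_eq]
  refine of_span_finset_eq_maximalIdeal (insert x t) ?_ ?_
  · have hsup : Ideal.comap π (Ideal.map π (Ideal.span t)) = maximalIdeal R := by
      rw [Ideal.map_span, himage, hs, ← map_mk_maximalIdeal,
        Ideal.comap_map_of_surjective' _ Ideal.Quotient.mk_surjective, Ideal.mk_ker]
      exact sup_eq_left.mpr ((Ideal.span_singleton_le_iff_mem _).mpr hx)
    rw [Ideal.comap_map_of_surjective' _ Ideal.Quotient.mk_surjective, Ideal.mk_ker] at hsup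
    rw [← hsup, Finset.coe_insert, Ideal.span_insert, sup_comm]
  · rw [← ringKrullDim_quotient_span_singleton_succ_eq_ringKrullDim hreg hx, ← hcard]
    exact_mod_cast (Finset.card_insert_le _ _).trans (Nat.succ_le_succ Finset.card_image_le)

end IsRegularLocalRing

lemma IsSMulRegular.of_free {R : Type u} [CommRing R] {M : Type w} [AddCommGroup M] [Module R M]
    [Module.Free R M] {x : R} (hx : IsSMulRegular R x) : IsSMulRegular M x := by
  intro a b hab
  refine (Module.Free.chooseBasis R M).repr.injective (hx.finsupp ?_)
  simpa using congr_arg (Module.Free.chooseBasis R M).repr hab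

namespace Module

section

variable {R : Type u} [CommRing R] [Small.{w} R]

/-- `M` has projective dimension at most `n`. -/
abbrev ProjDimLE (R : Type u) [CommRing R] [Small.{w} R] (M : Type w) [AddCommGroup M]
    [Module R M] (n : ℕ) : Prop :=
  HasProjectiveDimensionLE (ModuleCat.of R M) n

variable {M N P : Type w} [AddCommGroup M] [AddCommGroup N] [AddCommGroup P]
  [Module R M] [Module R N] [Module R P]

lemma projDimLE_zero_iff : ProjDimLE R M 0 ↔ Projective R M :=
  (projective_iff_hasProjectiveDimensionLE_zero (X := ModuleCat.of R M)).symm.trans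
    (IsProjective.iff_projective M).symm

lemma projDimLE_succ_iff_of_exact {f : M →ₗ[R] N} {g : N →ₗ[R] P} [Projective R N]
    (hfg : Function.Exact f g) (hf : Function.Injective f) (hg : Function.Surjective g) (n : ℕ) :
    ProjDimLE R P (n + 1) ↔ ProjDimLE R M n := by
  let S : ShortComplex (ModuleCat.{w} R) :=
    .mk (ModuleCat.ofHom f) (ModuleCat.ofHom g) (by ext x; exact hfg.apply_apply_eq_zero x)
  have hS : S.ShortExact := ModuleCat.shortComplex_shortExact S hfg hf hg
  exact hS.hasProjectiveDimensionLT_X₃_iff n ((IsProjective.iff_projective N).mp ‹_›)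

end

section

variable {R : Type u} [CommRing R]
variable {M N : Type w} [AddCommGroup M] [AddCommGroup N] [Module R M] [Module R N]

/-- The map `M / xM → N / xN` induced by `f`, as a map of `R / x`-modules. -/
noncomputable def quotSMulTopMap (x : R) (f : M →ₗ[R] N) :
    QuotSMulTop x M →ₗ[R ⧸ Ideal.span {x}] QuotSMulTop x N :=
  (QuotSMulTop.map x f).extendScalarsOfSurjective Ideal.Quotient.mk_surjective

lemma projDimLE_quotSMulTop_iff [Small.{w} R] [IsLocalRing R] [IsNoetherianRing R] {x : R}
    [Small.{w} (R ⧸ Ideal.span {x})]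
    (hx : x ∈ maximalIdeal R) (hxR : IsSMulRegular R x) (n : ℕ) (M : Type w) [AddCommGroup M]
    [Module R M] [Module.Finite R M] (hxM : IsSMulRegular M x) :
    ProjDimLE (R ⧸ Ideal.span {x}) (QuotSMulTop x M) n ↔ ProjDimLE R M n := by
  have := isLocalRing_quotient_span_singleton hx
  induction n generalizing M with
  | zero =>
    have : Module.Finite (R ⧸ Ideal.span {x}) (QuotSMulTop x M) :=
      .of_restrictScalars_finite R _ _
    have := Module.finitePresentation_of_finite R M
    have hiff := free_quotSMulTop_iff_free R M (maximalIdeal_le_jacobson _ hx) hxM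
    rw [projDimLE_zero_iff, projDimLE_zero_iff]
    refine ⟨fun _ ↦ ?_, fun _ ↦ ?_⟩
    · have := hiff.mp free_of_flat_of_isLocalRing
      infer_instance
    · have : Free R M := free_of_flat_of_isLocalRing
      infer_instance
  | succ n ih =>
    obtain ⟨P, _, _, _, _, f, hf⟩ := Module.exists_finite_presentation R M
    have hexact : Function.Exact (LinearMap.ker f).subtype f := f.exact_subtype_ker_map
    have hxP : IsSMulRegular P x := hxR.of_free
    have hxK : IsSMulRegular (LinearMap.ker f) x := hxP.submodule _ _
    have hzero : Function.Exact (0 : PUnit.{w + 1} →ₗ[R] LinearMap.ker f)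
        (LinearMap.ker f).subtype :=
      (LinearMap.exact_zero_iff_injective _ _).mpr (Submodule.subtype_injective _)
    have hinj : Function.Injective (QuotSMulTop.map x (LinearMap.ker f).subtype) := by
      have h := QuotSMulTop.map_first_exact_on_four_term_exact_of_isSMulRegular_last
        hzero hexact hxM
      rw [map_zero] at h
      exact (LinearMap.exact_zero_iff_injective _ _).mp h
    refine Iff.trans ?_ ((ih (LinearMap.ker f) hxK).trans
      (projDimLE_succ_iff_of_exact hexact (Submodule.subtype_injective _) hf n).symm)
    exact projDimLE_succ_iff_of_exact (f := quotSMulTopMap x (LinearMap.ker f).subtype)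
      (g := quotSMulTopMap x f) (QuotSMulTop.map_exact x hexact hf) hinj
      (QuotSMulTop.map_surjective x hf) n

end

end Module

namespace Module

open TensorProduct

lemma projDimLE_of_isRegularLocalRing (n : ℕ) (R : Type u) [CommRing R] [IsRegularLocalRing R]
    [Small.{w} R] (h : ringKrullDim R = n) (M : Type w) [AddCommGroup M] [Module R M]
    [Module.Finite R M] : ProjDimLE R M n := by
  induction n generalizing R M with
  | zero =>
    have hR := IsRegularLocalRing.isField_of_ringKrullDim_eq_zero (by simpa using h)
    let := hR.toField
    exact projDimLE_zero_iff.mpr (Projective.of_free (R := R))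
  | succ n ih =>
    have hbot := maximalIdeal_ne_bot_of_ringKrullDim_eq_succ h
    obtain ⟨x, hx, hx2, -⟩ := exists_mem_maximalIdeal_notMem_sq hbot Set.finite_empty
      (by simp) (by simp)
    obtain ⟨_, hdim⟩ := IsRegularLocalRing.quotient_span_singleton (by simpa using h) hx hx2
    have : Small.{w} (R ⧸ Ideal.span {x}) := small_of_surjective Ideal.Quotient.mk_surjective
    have hx0 : x ≠ 0 := fun h0 ↦ hx2 (h0 ▸ Submodule.zero_mem _)
    have := IsRegularLocalRing.isDomain_of_ringKrullDim_eq _ R h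
    have hxR : IsSMulRegular R x := fun a b hab ↦ mul_left_cancel₀ hx0 hab
    obtain ⟨P, _, _, _, _, f, hf⟩ := Module.exists_finite_presentation R M
    have hxP : IsSMulRegular P x := hxR.of_free
    rw [projDimLE_succ_iff_of_exact f.exact_subtype_ker_map (Submodule.subtype_injective _) hf,
      ← projDimLE_quotSMulTop_iff hx hxR n _ (hxP.submodule _ _)]
    have : Module.Finite (R ⧸ Ideal.span {x}) (QuotSMulTop x (LinearMap.ker f)) :=
      .of_restrictScalars_finite R _ _
    exact ih _ hdim _

lemma projDimLE_of_projDimLE_tensorProduct {A : Type u} {B : Type v} [CommRing A] [CommRing B]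
    [IsLocalRing A] [IsNoetherianRing A] [Algebra A B] [FaithfullyFlat A B] [Small.{w} A]
    [Small.{max v w} B] (n : ℕ) (M : Type w) [AddCommGroup M] [Module A M] [Module.Finite A M]
    (h : ProjDimLE B (B ⊗[A] M) n) : ProjDimLE A M n := by
  induction n generalizing M with
  | zero =>
    rw [projDimLE_zero_iff] at h ⊢
    have := Flat.of_flat_tensorProduct A M B
    have : Free A M := free_of_flat_of_isLocalRing
    infer_instance
  | succ n ih =>
    obtain ⟨P, _, _, _, _, f, hf⟩ := Module.exists_finite_presentation A M
    rw [projDimLE_succ_iff_of_exact f.exact_subtype_ker_map (Submodule.subtype_injective _) hf]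
    refine ih _ ?_
    rwa [projDimLE_succ_iff_of_exact (f := (LinearMap.ker f).subtype.baseChange B)
      (g := f.baseChange B) (lTensor_exact B f.exact_subtype_ker_map hf)
      (Flat.lTensor_preserves_injective_linearMap _ (Submodule.subtype_injective _))
      (LinearMap.lTensor_surjective B hf)] at h

lemma one_tmul_eq_zero_iff_of_basis {R : Type u} [CommRing R] [IsLocalRing R] {M : Type w}
    [AddCommGroup M] [Module R M] {ι : Type*} (b : Basis ι R M) (z : M) :
    (1 : ResidueField R) ⊗ₜ[R] z = 0 ↔ ∀ i, b.repr z i ∈ maximalIdeal R := by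
  rw [← (b.baseChange (ResidueField R)).repr.map_eq_zero_iff, Finsupp.ext_iff]
  refine forall_congr' fun i ↦ ?_
  rw [Basis.baseChange_repr_tmul, Finsupp.zero_apply, Algebra.smul_def, mul_one]
  exact residue_eq_zero_iff _

/-- Over a Noetherian local ring of depth zero, a finite module of finite projective dimension
is free. -/
lemma free_of_projDimLE {R : Type u} [CommRing R] [IsLocalRing R] [IsNoetherianRing R]
    [Small.{w} R] {s : R} (hs : s ≠ 0) (hms : ∀ a ∈ maximalIdeal R, s * a = 0) (n : ℕ)
    (M : Type w) [AddCommGroup M] [Module R M] [Module.Finite R M] (h : ProjDimLE R M n) :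
    Free R M := by
  induction n generalizing M with
  | zero =>
    have := projDimLE_zero_iff.mp h
    exact free_of_flat_of_isLocalRing
  | succ n ih =>
    obtain ⟨P, _, _, _, _, f, hf⟩ := Module.exists_finite_presentation R M
    rw [projDimLE_succ_iff_of_exact f.exact_subtype_ker_map (Submodule.subtype_injective _) hf]
      at h
    have := ih _ h
    refine free_of_lTensor_residueField_injective (LinearMap.ker f).subtype f hf
      f.exact_subtype_ker_map ((injective_iff_map_eq_zero _).mpr fun y hy ↦ ?_)
    obtain ⟨z, rfl⟩ := TensorProduct.mk_surjective R _ _ Ideal.Quotient.mk_surjective y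
    have hz : ∀ i, (Free.chooseBasis R P).repr (z : P) i ∈ maximalIdeal R :=
      (one_tmul_eq_zero_iff_of_basis _ _).mp hy
    have hsz : s • (z : P) = 0 := by
      refine (Free.chooseBasis R P).repr.map_eq_zero_iff.mp (Finsupp.ext fun i ↦ ?_)
      simpa using hms _ (hz i)
    refine (one_tmul_eq_zero_iff_of_basis (Free.chooseBasis R (LinearMap.ker f)) z).mpr fun i ↦ ?_
    by_contra hi
    refine hs ((notMem_maximalIdeal.mp hi).mul_left_eq_zero.mp ?_)
    have : s • z = 0 := Subtype.ext hsz
    simpa using DFunLike.congr_fun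
      (congr_arg (Free.chooseBasis R (LinearMap.ker f)).repr this) i

end Module

namespace IsLocalRing

open Pointwise

variable {R : Type u} [CommRing R] [IsLocalRing R]

/-- If `x ∈ 𝔪 \ 𝔪 ^ 2`, then the residue field is a direct summand of `𝔪 / x𝔪` over `R / x`. -/
lemma exists_residueField_retract_quotSMulTop {x : R} (hx : x ∈ maximalIdeal R)
    (hx2 : x ∉ maximalIdeal R ^ 2) [IsLocalRing (R ⧸ Ideal.span {x})] :
    ∃ (i : ResidueField (R ⧸ Ideal.span {x}) →ₗ[R ⧸ Ideal.span {x}]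
        QuotSMulTop x (maximalIdeal R))
      (p : QuotSMulTop x (maximalIdeal R) →ₗ[R ⧸ Ideal.span {x}]
        ResidueField (R ⧸ Ideal.span {x})), p ∘ₗ i = LinearMap.id := by
  let R' := R ⧸ Ideal.span {x}
  let k' := ResidueField R'
  have hmk {a : R} (ha : a ∈ maximalIdeal R) : algebraMap R k' a = 0 := by
    rw [IsScalarTower.algebraMap_apply R R' k']
    refine (residue_eq_zero_iff _).mpr ?_
    rw [← map_mk_maximalIdeal]
    exact Ideal.mem_map_of_mem _ ha
  have hx0 : (maximalIdeal R).toCotangent ⟨x, hx⟩ ≠ 0 := fun h ↦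
    hx2 ((Ideal.toCotangent_eq_zero _ _).mp h)
  obtain ⟨l, hl⟩ := Projective.exists_dual_eq_one (ResidueField R) (V := CotangentSpace R) hx0
  let e : ResidueField R →ₗ[R] k' :=
    (maximalIdeal R).liftQ (Algebra.linearMap R k') fun a ha ↦ hmk ha
  have he : e 1 = 1 := map_one (algebraMap R k')
  let p₀ : maximalIdeal R →ₗ[R] k' := e ∘ₗ l.restrictScalars R ∘ₗ (maximalIdeal R).toCotangent
  let p₁ : QuotSMulTop x (maximalIdeal R) →ₗ[R] k' :=
    (x • (⊤ : Submodule R (maximalIdeal R))).liftQ p₀ (by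
      intro y hy
      obtain ⟨z, -, rfl⟩ := (Submodule.mem_smul_pointwise_iff_exists _ _ _).mp hy
      rw [LinearMap.mem_ker, map_smul, Algebra.smul_def, hmk hx, zero_mul])
  let v : QuotSMulTop x (maximalIdeal R) := Submodule.Quotient.mk ⟨x, hx⟩
  have hv : p₁ v = 1 := by
    change e (l ((maximalIdeal R).toCotangent ⟨x, hx⟩)) = 1
    rw [hl, he]
  let i : k' →ₗ[R'] QuotSMulTop x (maximalIdeal R) :=
    (maximalIdeal R').liftQ (LinearMap.toSpanSingleton R' _ v) (by
      intro a ha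
      rw [← map_mk_maximalIdeal] at ha
      obtain ⟨b, hb, rfl⟩ := (Ideal.mem_map_iff_of_surjective _ Ideal.Quotient.mk_surjective).mp ha
      rw [LinearMap.mem_ker, LinearMap.toSpanSingleton_apply]
      refine (Submodule.Quotient.mk_eq_zero _).mpr
        ((Submodule.mem_smul_pointwise_iff_exists _ _ _).mpr ⟨⟨b, hb⟩, trivial, ?_⟩)
      exact Subtype.ext (mul_comm x b))
  refine ⟨i, p₁.extendScalarsOfSurjective Ideal.Quotient.mk_surjective, ?_⟩
  refine Submodule.linearMap_qext _ (LinearMap.ext_ring ?_)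
  change p₁ ((1 : R') • v) = 1
  rw [one_smul, hv]

end IsLocalRing

lemma exists_ringKrullDim_eq_natCast (R : Type u) [CommRing R] [FiniteRingKrullDim R] :
    ∃ d : ℕ, ringKrullDim R = d := by
  obtain ⟨d, hd⟩ := WithBot.ne_bot_iff_exists.mp (ringKrullDim_ne_bot (R := R))
  have hd' : d ≠ ⊤ := fun h ↦ ringKrullDim_ne_top (R := R) (by rw [← hd, h]; rfl)
  exact ⟨d.toNat, by rw [← hd, ← WithBot.coe_natCast, ENat.natCast_toNat hd']⟩

lemma Module.eq_zero_of_forall_smul_eq_zero {R : Type u} [CommRing R] {M : Type w}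
    [AddCommGroup M] [Module R M] [Module.Free R M] [Nontrivial M] {a : R}
    (h : ∀ y : M, a • y = 0) : a = 0 :=
  FaithfulSMul.eq_of_smul_eq_smul fun y : M ↦ (h y).trans (zero_smul R y).symm

namespace IsRegularLocalRing

lemma of_maximalIdeal_eq_bot {R : Type u} [CommRing R] [IsLocalRing R] [IsNoetherianRing R]
    (h : maximalIdeal R = ⊥) : IsRegularLocalRing R :=
  of_span_finset_eq_maximalIdeal ∅ (by simp [h]) (by simpa using ringKrullDim_nonneg_of_nontrivial)

/-- A Noetherian local ring whose residue field has finite projective dimension is regular. -/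
lemma of_projDimLE_residueField (n k : ℕ) (R : Type u) [CommRing R] [IsLocalRing R]
    [IsNoetherianRing R] (h : ringKrullDim R = n) (hk : ProjDimLE R (ResidueField R) k) :
    IsRegularLocalRing R := by
  induction n using Nat.strong_induction_on generalizing R k with
  | h n ih =>
  by_cases hm : maximalIdeal R = ⊥
  · exact of_maximalIdeal_eq_bot hm
  by_cases hass : maximalIdeal R ∈ associatedPrimes R R
  · obtain ⟨-, s, hs⟩ := isAssociatedPrime_iff.mp hass
    have hs0 : s ≠ 0 := by
      rintro rfl
      exact (maximalIdeal.isMaximal R).ne_top (by rw [hs]; simp)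
    have : Module.Free R (ResidueField R) := free_of_projDimLE hs0 (fun a ha ↦ by
      rw [hs, Submodule.mem_colon_singleton, Submodule.mem_bot] at ha
      rwa [mul_comm]) k _ hk
    refine absurd ((Submodule.eq_bot_iff _).mpr fun a ha ↦ ?_) hm
    have : Nontrivial (ResidueField R) := Field.toNontrivial
    refine eq_zero_of_forall_smul_eq_zero (M := ResidueField R) fun y ↦ ?_
    rw [Algebra.smul_def]
    exact mul_eq_zero_of_left ((residue_eq_zero_iff a).mpr ha) y
  obtain ⟨x, hx, hx2, hxp⟩ := exists_mem_maximalIdeal_notMem_sq hm (associatedPrimes.finite R R)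
    (fun p hp ↦ hp.isPrime) (fun p hp hpm ↦ hass (hpm ▸ hp))
  have hxR : IsSMulRegular R x := by
    have hx0 : x ∉ ⋃ p ∈ associatedPrimes R R, (p : Set R) := by simpa using hxp
    rw [biUnion_associatedPrimes_eq_compl_nonZeroDivisors, Set.mem_compl_iff, not_not] at hx0
    exact fun a b hab ↦ mul_cancel_left_mem_nonZeroDivisors hx0 |>.mp hab
  have := isLocalRing_quotient_span_singleton hx
  have hk1 : ProjDimLE R (ResidueField R) (k + 1) :=
    hasProjectiveDimensionLT_of_ge (n := k + 1) _ _ (Nat.le_succ _)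
  have hm1 : ProjDimLE R (maximalIdeal R) k := by
    refine (projDimLE_succ_iff_of_exact (f := (maximalIdeal R).subtype)
      (g := Algebra.linearMap R (ResidueField R)) (fun a ↦ ?_) Subtype.val_injective
      residue_surjective k).mp hk1
    exact (residue_eq_zero_iff a).trans (by rw [Submodule.coe_subtype, Subtype.range_coe]; rfl)
  have hquot := (projDimLE_quotSMulTop_iff hx hxR k _ (hxR.submodule (maximalIdeal R) x)).mpr hm1
  obtain ⟨i, p, hpi⟩ := exists_residueField_retract_quotSMulTop hx hx2
  let ρ : Retract (ModuleCat.of (R ⧸ Ideal.span {x}) (ResidueField (R ⧸ Ideal.span {x})))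
      (ModuleCat.of (R ⧸ Ideal.span {x}) (QuotSMulTop x (maximalIdeal R))) :=
    ⟨ModuleCat.ofHom i, ModuleCat.ofHom p, by rw [← ModuleCat.ofHom_comp, hpi]; rfl⟩
  have hres : ProjDimLE (R ⧸ Ideal.span {x}) (ResidueField (R ⧸ Ideal.span {x})) k :=
    ρ.hasProjectiveDimensionLT (k + 1)
  have hdim := ringKrullDim_quotient_span_singleton_succ_eq_ringKrullDim hxR hx
  obtain ⟨d, hd⟩ := exists_ringKrullDim_eq_natCast (R ⧸ Ideal.span {x})
  rw [hd, h] at hdim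
  have := ih d (by have : d + 1 = n := by exact_mod_cast hdim
                   lia) k _ hd hres
  exact of_quotient_span_singleton hx hxR

end IsRegularLocalRing

/-- Regularity descends along faithfully flat extensions of Noetherian local rings. -/
lemma IsRegularLocalRing.of_faithfullyFlat (A : Type u) (B : Type v) [CommRing A] [CommRing B]
    [IsLocalRing A] [IsNoetherianRing A] [IsRegularLocalRing B] [Algebra A B]
    [FaithfullyFlat A B] : IsRegularLocalRing A := by
  obtain ⟨n, hn⟩ := exists_ringKrullDim_eq_natCast B
  obtain ⟨d, hd⟩ := exists_ringKrullDim_eq_natCast A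
  let k := ULift.{max u v} (ResidueField A)
  have hk : ProjDimLE A k n :=
    projDimLE_of_projDimLE_tensorProduct (B := B) n k (projDimLE_of_isRegularLocalRing n B hn _)
  have : HasProjectiveDimensionLE (ModuleCat.of A k) n := hk
  exact of_projDimLE_residueField d n A hd
    (ModuleCat.hasProjectiveDimensionLE_of_linearEquiv (M := ModuleCat.of A k)
      (N := ModuleCat.of A (ResidueField A)) ULift.moduleEquiv n)

end

theorem stmt6 {A B : Type*} [CommRing A] [CommRing B]
    [IsLocalRing A] [IsLocalRing B] [IsNoetherianRing A] [IsNoetherianRing B]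
    (φ : A →+* B) [IsLocalHom φ]
    (hflat : @Module.Flat A B _ _ (φ.toAlgebra.toModule))
    (hB : IsRegularLocal B) : IsRegularLocal A := by
  let := φ.toAlgebra
  obtain ⟨-, s, hs, hcard⟩ := hB
  have := IsRegularLocalRing.of_span_finset_eq_maximalIdeal s hs hcard.le
  have : IsLocalHom (algebraMap A B) := ‹IsLocalHom φ›
  have := Module.FaithfullyFlat.of_flat_of_isLocalHom (A := A) (B := B)
  have hA := IsRegularLocalRing.of_faithfullyFlat A B
  obtain ⟨t, ht, htcard⟩ := IsRegularLocalRing.exists_finset (R := A)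
  exact ⟨inferInstance, t, ht, htcard⟩
end

section
/- Let f : X → Y be a finite surjective morphism of irreducible Noetherian schemes of finite Krull dimension. If Z ⊆ Y is a Zariski-dense subset, then f⁻¹(Z) is Zariski-dense in X. -/
open AlgebraicGeometry in
/-- Two points of a fibre of a locally quasi-finite morphism, one specializing to the other,
are equal. -/
theorem AlgebraicGeometry.LocallyQuasiFinite.eq_of_specializes {X Y : Scheme} (f : X ⟶ Y)
    [LocallyQuasiFinite f] {x y : X} (h : x ⤳ y) (hxy : f x = f y) : x = y := by
  have := (f.isDiscrete_preimage_singleton (f y)).to_subtype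
  have key : (⟨x, hxy⟩ : f ⁻¹' {f y}) ⤳ ⟨y, rfl⟩ :=
    Topology.IsInducing.subtypeVal.specializes_iff.mp h
  exact congrArg Subtype.val key.eq

open AlgebraicGeometry in
theorem stmt7 {X Y : Scheme} (f : X ⟶ Y) [IsFinite f]
    (hsurj : Function.Surjective f.base)
    [IrreducibleSpace X] [IrreducibleSpace Y]
    [AlgebraicGeometry.IsNoetherian X] [AlgebraicGeometry.IsNoetherian Y]
    (hdX : topologicalKrullDim X ≠ ⊤) (hdY : topologicalKrullDim Y ≠ ⊤)
    (Z : Set Y) (hZ : Dense Z) : Dense (f.base ⁻¹' Z) := by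
  have himage : f '' closure (f ⁻¹' Z) = Set.univ := by
    rw [← (f.isClosedMap _ isClosed_closure).closure_eq]
    refine (hZ.mono ?_).closure_eq
    intro z hz
    obtain ⟨x, rfl⟩ := hsurj z
    exact ⟨x, subset_closure hz, rfl⟩
  obtain ⟨w, hw, hwη⟩ := himage.ge (Set.mem_univ (f (genericPoint X)))
  have hη : genericPoint X = w :=
    LocallyQuasiFinite.eq_of_specializes f (genericPoint_specializes w) hwη.symm
  intro x
  exact (genericPoint_specializes x).mem_closed isClosed_closure (hη ▸ hw)
end
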